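/- Let ρ > 0 and suppose the kernel of the RKHS (H, ι, k) is translation invariant with covariance tensor b, and that b is isotropic. Then there exists V ∈ H with ⟨(ι V)(ρθ), θ⟩ < 0 for every θ ∈ S^{d-1} (i.e. a vector field in H pointing strictly inwards on the sphere of radius ρ) if and only if ∫_{S^{d-1}} ∫_{S^{d-1}} ⟨b(ρθ − ρφ)θ, φ⟩ dσ(θ) dσ(φ) > 0. -/

import Mathlib

open MeasureTheory RealInnerProductSpace

/-- The orthogonal group acts transitively on every sphere centered at the origin. -/
theorem exists_linearIsometryEquiv_apply_eq {E : Type*} [NormedAddCommGroup E]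
    [InnerProductSpace ℝ E] {u v : E} (h : ‖u‖ = ‖v‖) : ∃ O : E ≃ₗᵢ[ℝ] E, O u = v :=
  ⟨_, Submodule.reflection_sub h⟩

/-- Let `σ` be the uniform (rotation-invariant) probability measure on the
unit sphere of `ℝ^d`, and let `(H, ι, k)` be an RKHS of vector fields on `ℝ^d` whose kernel is
translation invariant with isotropic covariance tensor `b`.  For `ρ > 0`, there exists
`V ∈ H` pointing strictly inwards on the sphere of radius `ρ` (i.e. `⟪(ι V)(ρθ), θ⟫ < 0` for
every unit vector `θ`) if and only if `∫∫ ⟪b(ρθ − ρφ)θ, φ⟫ dσ(θ) dσ(φ) > 0`. -/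
theorem statement6 (d : ℕ) (hd : 2 ≤ d)
    (σ : Measure (EuclideanSpace ℝ (Fin d))) [IsProbabilityMeasure σ]
    (hσsphere : σ (Metric.sphere (0 : EuclideanSpace ℝ (Fin d)) 1)ᶜ = 0)
    (hσinv : ∀ O : EuclideanSpace ℝ (Fin d) ≃ₗᵢ[ℝ] EuclideanSpace ℝ (Fin d),
      Measure.map (⇑O) σ = σ)
    (H : Type*) [NormedAddCommGroup H] [InnerProductSpace ℝ H] [CompleteSpace H]
    (ι : H →ₗ[ℝ] (EuclideanSpace ℝ (Fin d) → EuclideanSpace ℝ (Fin d)))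
    (hι : Function.Injective ι)
    (k : EuclideanSpace ℝ (Fin d) → EuclideanSpace ℝ (Fin d) → H)
    (hk : Continuous fun p : EuclideanSpace ℝ (Fin d) × EuclideanSpace ℝ (Fin d) =>
      k p.1 p.2)
    (hrep : ∀ (f : H) (x ξ : EuclideanSpace ℝ (Fin d)), ⟪f, k x ξ⟫ = ⟪ι f x, ξ⟫)
    (b : EuclideanSpace ℝ (Fin d) →
      (EuclideanSpace ℝ (Fin d) →L[ℝ] EuclideanSpace ℝ (Fin d)))
    (hbcont : Continuous b)
    (htransl : ∀ x ξ y : EuclideanSpace ℝ (Fin d), ι (k x ξ) y = b (x - y) ξ)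
    (hiso : ∀ (O : EuclideanSpace ℝ (Fin d) ≃ₗᵢ[ℝ] EuclideanSpace ℝ (Fin d))
      (x v : EuclideanSpace ℝ (Fin d)), b x v = O.symm (b (O x) (O v)))
    (ρ : ℝ) (hρ : 0 < ρ) :
    (∃ V : H, ∀ θ ∈ Metric.sphere (0 : EuclideanSpace ℝ (Fin d)) 1,
        ⟪ι V (ρ • θ), θ⟫ < 0) ↔
      0 < ∫ φ, ∫ θ, ⟪b (ρ • θ - ρ • φ) θ, φ⟫ ∂σ ∂σ := by
  set F : EuclideanSpace ℝ (Fin d) → H := fun θ => k (ρ • θ) θ with hF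
  have hFc : Continuous F := hk.comp ((continuous_const_smul ρ).prodMk continuous_id)
  have hmem : ∀ᵐ θ ∂σ, θ ∈ Metric.sphere (0 : EuclideanSpace ℝ (Fin d)) 1 :=
    mem_ae_iff.2 hσsphere
  have hFi : Integrable F σ := by
    have h := hFc.continuousOn.integrableOn_compact (μ := σ)
      (isCompact_sphere (0 : EuclideanSpace ℝ (Fin d)) 1)
    rwa [IntegrableOn, Measure.restrict_eq_self_of_ae_mem hmem] at h
  have hker : ∀ θ φ, ⟪b (ρ • θ - ρ • φ) θ, φ⟫ = ⟪F φ, F θ⟫ := fun θ φ => by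
    rw [← htransl, ← hrep, real_inner_comm]
  set W : H := ∫ θ, F θ ∂σ with hW
  have hinner : ∀ V : H, ∫ θ, ⟪V, F θ⟫ ∂σ = ⟪V, W⟫ := fun V => integral_inner hFi V
  have hdouble : ∫ φ, ∫ θ, ⟪b (ρ • θ - ρ • φ) θ, φ⟫ ∂σ ∂σ = ⟪W, W⟫ := by
    simp only [hker, hinner]
    rw [← hinner W]
    exact integral_congr_ae (.of_forall fun φ => real_inner_comm _ _)
  rw [hdouble, real_inner_self_pos]
  constructor
  · rintro ⟨V, hV⟩ hW0
    have hneg : ∀ᵐ θ ∂σ, ⟪V, F θ⟫ < 0 := hmem.mono fun θ hθ => by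
      simpa only [hF, hrep] using hV θ hθ
    have hzero : ∫ θ, -⟪V, F θ⟫ ∂σ = 0 := by
      rw [integral_neg, hinner, hW0, inner_zero_right, neg_zero]
    have hae := (integral_eq_zero_iff_of_nonneg_ae
      (hneg.mono fun θ hθ => by simpa using hθ.le) (hFi.const_inner V).neg).1 hzero
    obtain ⟨θ, h1, h2⟩ := (hneg.and hae).exists
    simp only [Pi.zero_apply, Pi.neg_apply, neg_eq_zero] at h2
    exact h1.ne h2
  · intro hW0
    have hinv : ∀ (O : EuclideanSpace ℝ (Fin d) ≃ₗᵢ[ℝ] EuclideanSpace ℝ (Fin d)) φ,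
        ⟪F (O φ), W⟫ = ⟪F φ, W⟫ := fun O φ => by
      have hFO : ∀ θ, ⟪F (O φ), F (O θ)⟫ = ⟪F φ, F θ⟫ := fun θ => by
        rw [← hker, ← hker, hiso O (ρ • θ - ρ • φ) θ, ← O.inner_map_map (O.symm _) φ]
        simp
      rw [← hinner, ← hinner]
      conv_lhs => rw [← hσinv O]
      rw [integral_map O.continuous.aemeasurable
        (continuous_const.inner hFc).aestronglyMeasurable]
      simp only [hFO]
    refine ⟨-W, fun θ hθ => ?_⟩
    have hconst : ∀ᵐ φ ∂σ, ⟪W, F φ⟫ = ⟪W, F θ⟫ := hmem.mono fun φ hφ => by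
      obtain ⟨O, rfl⟩ := exists_linearIsometryEquiv_apply_eq (u := θ) (v := φ)
        (by rw [mem_sphere_zero_iff_norm.1 hθ, mem_sphere_zero_iff_norm.1 hφ])
      rw [real_inner_comm, hinv, real_inner_comm]
    have hval : ⟪W, W⟫ = ⟪W, F θ⟫ := by
      rw [← hinner, integral_congr_ae hconst]
      simp
    rw [← hrep, inner_neg_left, neg_lt_zero]
    exact hval ▸ real_inner_self_pos.2 hW0
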